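/- arXiv:2409.01929 — 2 statements merged into one kernel-verified Lean document; each statement's English description precedes it below -/
import Mathlib

section
/- Let f ∈ 𝔽_q[x] be a nonconstant monic polynomial and D = {f_1, …, f_k} a set of monic proper divisors of f such that: (1) deg(f_i) ≥ 1 for all i; (2) the f_i are pairwise relatively prime, i.e. gcd(f_i, f_j) = 1 for all i ≠ j; (3) k ≥ 3; (4) q ≠ 2. Then the gcd-graph G_f(D) is not a perfect graph. -/
open Polynomial

/-- A graph is perfect if for every induced subgraph, the chromatic number equals the
clique number. -/
def IsPerfectGraph {V : Type} (G : SimpleGraph V) : Prop :=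
  ∀ s : Set V, (G.induce s).chromaticNumber = ((G.induce s).cliqueNum : ℕ∞)

variable {Fq : Type} [Field Fq] [Fintype Fq] [DecidableEq Fq]

/-- The gcd-graph `G_f(D)`: vertices are `𝔽_q[x]/(f)`, and two distinct vertices are adjacent
iff the (monic, normalized) gcd of a representative of their difference with `f` lies in `D`. -/
def gcdGraph (f : Polynomial Fq) (D : Finset (Polynomial Fq)) :
    SimpleGraph (AdjoinRoot f) :=
  SimpleGraph.fromRel fun u v =>
    ∃ p : Polynomial Fq, AdjoinRoot.mk f p = u - v ∧ gcd p f ∈ D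

/-- Codes of the vertices of an induced `5`-cycle: the first three coordinates prescribe residues
modulo three members of `D`, and the last one is a proper colouring of the cycle. -/
def holeCode : Fin 5 → Fin 4 → Fin 3 :=
  ![![0, 0, 0, 0], ![0, 1, 1, 1], ![0, 0, 2, 0], ![0, 1, 0, 1], ![1, 2, 0, 2]]

lemma holeCode_of_adj : ∀ i j : Fin 5, (SimpleGraph.cycleGraph 5).Adj i j →
    ∃ a : Fin 4, a ≠ 3 ∧ holeCode i a = holeCode j a ∧
      ∀ b, b ≠ a → holeCode i b ≠ holeCode j b := by
  decide

lemma holeCode_of_not_adj : ∀ i j : Fin 5, i ≠ j → ¬ (SimpleGraph.cycleGraph 5).Adj i j →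
    (∃ a b : Fin 4, a ≠ 3 ∧ b ≠ 3 ∧ a ≠ b ∧ holeCode i a = holeCode j a ∧
      holeCode i b = holeCode j b) ∨ ∀ b, holeCode i b ≠ holeCode j b := by
  decide

/-- A perfect graph has no induced `5`-cycle. -/
lemma not_isPerfectGraph_of_embedding {V : Type} {G : SimpleGraph V}
    (φ : SimpleGraph.cycleGraph 5 ↪g G) : ¬ IsPerfectGraph G := by
  intro h
  let e : SimpleGraph.cycleGraph 5 ≃g G.induce (Set.range φ) :=
    { Equiv.ofInjective φ φ.injective with
      map_rel_iff' := by intro a b; simp }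
  have hχ : (G.induce (Set.range φ)).chromaticNumber = 3 := by
    rw [← SimpleGraph.chromaticNumber_cycleGraph_of_odd 5 (by norm_num) (by decide)]
    exact le_antisymm (SimpleGraph.chromaticNumber_mono_of_hom e.symm.toHom)
      (SimpleGraph.chromaticNumber_mono_of_hom e.toHom)
  have hω : (G.induce (Set.range φ)).cliqueNum = 3 := by
    exact_mod_cast (h (Set.range φ)).symm.trans hχ
  obtain ⟨t, ht⟩ := (G.induce (Set.range φ)).exists_isNClique_cliqueNum
  rw [hω] at ht
  have key : (SimpleGraph.cycleGraph 5).CliqueFree 3 := by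
    intro s hs
    obtain ⟨a, b, c, hab, hac, hbc, -⟩ := SimpleGraph.is3Clique_iff.1 hs
    revert a b c
    decide
  exact (key.comap e.symm.toEmbedding.toCopy.isContained) t ht

/-- The part of `f` away from `p`, up to multiplicities. -/
lemma exists_isCoprime_cover {R : Type*} [CommRing R] [IsDomain R] [IsPrincipalIdealRing R]
    (p f : R) (hf : f ≠ 0) :
    ∃ r, IsCoprime p r ∧ ∀ z, Prime z → z ∣ f → z ∣ p ∨ z ∣ r := by
  induction f using UniqueFactorizationMonoid.induction_on_prime with
  | h₁ => exact absurd rfl hf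
  | h₂ x hx => exact ⟨1, isCoprime_one_right, fun z hz h =>
      (hz.not_isUnit (isUnit_of_dvd_unit h hx)).elim⟩
  | h₃ a q ha hq ih =>
    obtain ⟨r, hr, hcov⟩ := ih ha
    by_cases hqp : q ∣ p
    · refine ⟨r, hr, fun z hz h => ?_⟩
      rcases hz.dvd_or_dvd h with h | h
      · exact Or.inl (h.trans hqp)
      · exact hcov z hz h
    · refine ⟨q * r, ((hq.irreducible.coprime_iff_not_dvd.2 hqp).symm).mul_right hr,
        fun z hz h => ?_⟩
      rcases hz.dvd_or_dvd h with h | h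
      · exact Or.inr (h.mul_right r)
      · exact (hcov z hz h).imp_right (·.mul_left q)

/-- Coprimality to `f` can be tested on a family covering all primes dividing `f`. -/
lemma isCoprime_of_cover {R ι : Type*} [CommRing R] [IsDomain R] [IsPrincipalIdealRing R]
    {f w : R} {d : ι → R} (hf : f ≠ 0) (hcov : ∀ z, Prime z → z ∣ f → ∃ b, z ∣ d b)
    (hw : ∀ b, IsCoprime w (d b)) : IsCoprime w f := by
  refine isCoprime_of_prime_dvd (fun h => hf h.2) fun z hz hzw hzf => ?_
  obtain ⟨b, hb⟩ := hcov z hz hzf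
  exact hz.not_isUnit ((hw b).isUnit_of_dvd' hzw hb)

lemma pairwise_isCoprime_vec {R : Type*} [CommSemiring R] {a b c d : R} (hab : IsCoprime a b)
    (hac : IsCoprime a c) (had : IsCoprime a d) (hbc : IsCoprime b c) (hbd : IsCoprime b d)
    (hcd : IsCoprime c d) :
    Pairwise fun i j => IsCoprime (![a, b, c, d] i) (![a, b, c, d] j) := by
  simp [Pairwise, Fin.forall_fin_succ, hab, hac, had, hbc, hbd, hcd, hab.symm, hac.symm,
    had.symm, hbc.symm, hbd.symm, hcd.symm]

/-- The Chinese remainder theorem with pairwise coprime moduli `d a ^ 2`. -/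
lemma exists_sub_dvd_sq {R ι : Type*} [CommRing R] [Finite ι] {d : ι → R}
    (hd : Pairwise fun a b => IsCoprime (d a) (d b)) (x : ι → R) :
    ∃ P, ∀ a, d a ^ 2 ∣ P - x a := by
  obtain ⟨P, hP⟩ := Ideal.exists_forall_sub_mem_ideal
    (I := fun a => Ideal.span {d a ^ 2})
    (fun a b hab => (Ideal.isCoprime_span_singleton_iff _ _).2 (hd hab).pow) x
  exact ⟨P, fun a => Ideal.mem_span_singleton.1 (hP a)⟩

lemma isCoprime_C_add_mul {F : Type*} [Field F] {c : F} (hc : c ≠ 0) (d t : F[X]) : IsCoprime (C c + d * t) d :=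
  IsCoprime.add_mul_left_left
    ⟨C c⁻¹, 0, by rw [← C_mul, inv_mul_cancel₀ hc, C_1, zero_mul, add_zero]⟩ t

section

variable {F : Type} [Field F] [DecidableEq F]

lemma gcd_mul_eq_of_isCoprime {f d w : F[X]} (hd : d.Monic) (hdf : d ∣ f) (hw : IsCoprime w f) :
    gcd (d * w) f = d := by
  obtain ⟨h, rfl⟩ := hdf
  rw [gcd_mul_left, hd.normalize_eq_self,
    ← normalize_gcd w h,
    normalize_eq_one.2 ((gcd_isUnit_iff w h).2 hw.of_mul_right_right), mul_one]

/-- Differences modulo `f` have a well-defined gcd with `f`. -/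
lemma gcd_eq_of_mk_eq {f p p' : F[X]} (h : AdjoinRoot.mk f p = AdjoinRoot.mk f p') :
    gcd p f = gcd p' f := by
  obtain ⟨t, ht⟩ := AdjoinRoot.mk_eq_mk.1 h
  have hp : p = p' + f * t := by rw [← ht]; ring
  rw [hp]
  refine dvd_antisymm_of_normalize_eq (normalize_gcd _ _) (normalize_gcd _ _) ?_ ?_
  · exact dvd_gcd ((dvd_add_left ((gcd_dvd_right _ _).mul_right t)).1 (gcd_dvd_left _ _))
      (gcd_dvd_right _ _)
  · exact dvd_gcd (dvd_add (gcd_dvd_left _ _) ((gcd_dvd_right _ _).mul_right t))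
      (gcd_dvd_right _ _)

lemma gcdGraph_adj_mk {f : F[X]} {D : Finset F[X]} (hD : ∀ d ∈ D, d.Monic ∧ d ∣ f ∧ d ≠ f)
    (hf : f.Monic) (p p' : F[X]) :
    (gcdGraph f D).Adj (AdjoinRoot.mk f p) (AdjoinRoot.mk f p') ↔ gcd (p - p') f ∈ D := by
  have key : ∀ p p' : F[X], (∃ r, AdjoinRoot.mk f r = AdjoinRoot.mk f p - AdjoinRoot.mk f p' ∧
      gcd r f ∈ D) ↔ gcd (p - p') f ∈ D := by
    intro p p'
    constructor
    · rintro ⟨r, hr, hrD⟩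
      rw [← map_sub] at hr
      rwa [← gcd_eq_of_mk_eq hr]
    · exact fun h => ⟨p - p', map_sub _ _ _, h⟩
  have hsymm : gcd (p' - p) f = gcd (p - p') f := by
    rw [← neg_sub p p']
    exact dvd_antisymm_of_normalize_eq (normalize_gcd _ _) (normalize_gcd _ _)
      (gcd_dvd_gcd (neg_dvd.2 dvd_rfl) dvd_rfl) (gcd_dvd_gcd (dvd_neg.2 dvd_rfl) dvd_rfl)
  rw [gcdGraph, SimpleGraph.fromRel_adj, key, key, hsymm, or_self, and_iff_right_iff_imp]
  intro h heq
  have h0 : gcd (p - p') f = f := by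
    rw [gcd_eq_of_mk_eq (p' := 0) (by rw [map_sub, heq, sub_self, map_zero]), gcd_zero_left,
      hf.normalize_eq_self]
  exact (hD _ h).2.2 h0

/-- The `5`-cycle `holeCode` is an induced subgraph of the gcd-graph. -/
lemma exists_cycleGraph_embedding {f : F[X]} (hf : f.Monic)
    {D : Finset F[X]} (hD : ∀ d ∈ D, d.Monic ∧ d ∣ f ∧ d ≠ f)
    (hdegD : ∀ d ∈ D, 1 ≤ d.natDegree)
    (hcop : ∀ d₁ ∈ D, ∀ d₂ ∈ D, d₁ ≠ d₂ → IsCoprime d₁ d₂)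
    {d : Fin 4 → F[X]} (hd : Pairwise fun a b => IsCoprime (d a) (d b))
    (hdD : ∀ a, a ≠ 3 → d a ∈ D) (hcov : ∀ z, Prime z → z ∣ f → ∃ b, z ∣ d b)
    (γ : Fin 3 ↪ F) : Nonempty (SimpleGraph.cycleGraph 5 ↪g gcdGraph f D) := by
  choose P hP using fun i : Fin 5 => exists_sub_dvd_sq hd
    (fun a => C (γ (holeCode i a)) + d a * C (γ (holeCode i 3)))
  have hdiff : ∀ i j a, ∃ t, P i - P j = C (γ (holeCode i a) - γ (holeCode j a)) +
      d a * (C (γ (holeCode i 3) - γ (holeCode j 3)) + d a * t) := by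
    intro i j a
    obtain ⟨s, hs⟩ := hP i a
    obtain ⟨t, ht⟩ := hP j a
    refine ⟨s - t, ?_⟩
    rw [C_sub, C_sub]
    linear_combination hs - ht
  have hne : ∀ i j a, holeCode i a ≠ holeCode j a → IsCoprime (P i - P j) (d a) := by
    intro i j a h
    obtain ⟨t, ht⟩ := hdiff i j a
    rw [ht]
    exact isCoprime_C_add_mul (sub_ne_zero.2 (γ.injective.ne h)) _ _
  have heq : ∀ i j a, holeCode i a = holeCode j a → d a ∣ P i - P j := by
    intro i j a h
    obtain ⟨t, ht⟩ := hdiff i j a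
    rw [ht, h, sub_self, C_0, zero_add]
    exact dvd_mul_right _ _
  have hunit : ∀ e ∈ D, ¬ IsUnit e := fun e he h => by
    have := hdegD e he
    rw [natDegree_eq_zero_of_isUnit h] at this
    omega
  have hadj : ∀ i j, (SimpleGraph.cycleGraph 5).Adj i j → gcd (P i - P j) f ∈ D := by
    intro i j hij
    obtain ⟨a, ha3, ha, hb⟩ := holeCode_of_adj i j hij
    obtain ⟨t, ht⟩ := hdiff i j a
    rw [ha, sub_self, C_0, zero_add] at ht
    have hw : IsCoprime (C (γ (holeCode i 3) - γ (holeCode j 3)) + d a * t) f := by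
      refine isCoprime_of_cover hf.ne_zero hcov fun b => ?_
      by_cases hba : b = a
      · rw [hba]
        exact isCoprime_C_add_mul (sub_ne_zero.2 (γ.injective.ne (hb 3 ha3.symm))) _ _
      · have := hne i j b (hb b hba)
        rw [ht] at this
        exact this.of_mul_left_right
    rw [ht, gcd_mul_eq_of_isCoprime (hD _ (hdD a ha3)).1 (hD _ (hdD a ha3)).2.1 hw]
    exact hdD a ha3
  have hnadj : ∀ i j, i ≠ j → ¬ (SimpleGraph.cycleGraph 5).Adj i j →
      gcd (P i - P j) f ∉ D := by
    intro i j hij hnij hmem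
    rcases holeCode_of_not_adj i j hij hnij with ⟨a, b, ha3, hb3, hab, ha, hb⟩ | hall
    · have hg : ∀ c, c ≠ 3 → holeCode i c = holeCode j c → d c = gcd (P i - P j) f := by
        intro c hc3 hc
        by_contra hcon
        exact hunit _ (hdD c hc3) ((hcop _ (hdD c hc3) _ hmem hcon).isUnit_of_dvd' dvd_rfl
          (dvd_gcd (heq i j c hc) (hD _ (hdD c hc3)).2.1))
      have hself : IsCoprime (d a) (d b) := hd hab
      rw [hg a ha3 ha, hg b hb3 hb] at hself
      exact hunit _ hmem (isCoprime_self.1 hself)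
    · exact hunit _ hmem ((isCoprime_of_cover hf.ne_zero hcov fun b =>
        hne i j b (hall b)).isUnit_of_dvd' (gcd_dvd_left _ _) (gcd_dvd_right _ _))
  have hiff : ∀ i j, (gcdGraph f D).Adj (AdjoinRoot.mk f (P i)) (AdjoinRoot.mk f (P j)) ↔
      (SimpleGraph.cycleGraph 5).Adj i j := by
    intro i j
    by_cases hij : i = j
    · subst hij
      simp
    · rw [gcdGraph_adj_mk hD hf]
      exact ⟨fun h => by_contra fun hn => hnadj i j hij hn h, hadj i j⟩
  have hsep : ∀ i j : Fin 5, (∀ k, (SimpleGraph.cycleGraph 5).Adj i k ↔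
      (SimpleGraph.cycleGraph 5).Adj j k) → i = j := by
    decide
  exact ⟨⟨⟨fun i => AdjoinRoot.mk f (P i), fun i j hij => hsep i j fun k => by
    have hij : AdjoinRoot.mk f (P i) = AdjoinRoot.mk f (P j) := hij
    rw [← hiff, ← hiff, hij]⟩, fun {i j} => hiff i j⟩⟩

end

/-- If `D` consists of at least three nonconstant, pairwise relatively prime monic proper
divisors of `f`, and `q ≠ 2`, then `G_f(D)` is not perfect. -/
theorem gcdGraph_not_perfect
    (f : Polynomial Fq) (hf : f.Monic) (hdeg : 0 < f.natDegree)
    (D : Finset (Polynomial Fq)) (hD : ∀ d ∈ D, d.Monic ∧ d ∣ f ∧ d ≠ f)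
    (hdegD : ∀ d ∈ D, 1 ≤ d.natDegree)
    (hcop : ∀ d₁ ∈ D, ∀ d₂ ∈ D, d₁ ≠ d₂ → gcd d₁ d₂ = 1)
    (hcard : 3 ≤ D.card)
    (hq : Fintype.card Fq ≠ 2) :
    ¬ IsPerfectGraph (gcdGraph f D) := by
  obtain ⟨d₀, h₀, d₁, h₁, d₂, h₂, h₀₁, h₀₂, h₁₂⟩ := Finset.two_lt_card.1 hcard
  have hcop' : ∀ d₁ ∈ D, ∀ d₂ ∈ D, d₁ ≠ d₂ → IsCoprime d₁ d₂ := fun a ha b hb hab =>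
    (gcd_isUnit_iff a b).1 (hcop a ha b hb hab ▸ isUnit_one)
  obtain ⟨r, hr, hcov⟩ := exists_isCoprime_cover (d₀ * d₁ * d₂) f hf.ne_zero
  have hr₂ := hr.of_mul_left_right
  have hr₁ := hr.of_mul_left_left.of_mul_left_right
  have hr₀ := hr.of_mul_left_left.of_mul_left_left
  have c₀₁ := hcop' _ h₀ _ h₁ h₀₁
  have c₀₂ := hcop' _ h₀ _ h₂ h₀₂
  have c₁₂ := hcop' _ h₁ _ h₂ h₁₂
  have hcardF : 3 ≤ Fintype.card Fq := by
    have := Fintype.one_lt_card (α := Fq)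
    omega
  obtain ⟨γ⟩ := Function.Embedding.nonempty_of_card_le (α := Fin 3) (β := Fq) (by simpa)
  obtain ⟨φ⟩ := exists_cycleGraph_embedding hf hD hdegD hcop' (d := ![d₀, d₁, d₂, r])
    (pairwise_isCoprime_vec c₀₁ c₀₂ hr₀ c₁₂ hr₁ hr₂)
    (by simp [Fin.forall_fin_succ, h₀, h₁, h₂])
    (by
      intro z hz hzf
      rcases hcov z hz hzf with h | h
      · rcases hz.dvd_or_dvd h with h | h
        · rcases hz.dvd_or_dvd h with h | h
          · exact ⟨0, h⟩
          · exact ⟨1, h⟩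
        · exact ⟨2, h⟩
      · exact ⟨3, h⟩) γ
  exact not_isPerfectGraph_of_embedding φ
end

section
/- Let G be a finite simple graph and q a prime power. Then there exists a positive integer r such that for every d ≥ r there is a monic polynomial F_d ∈ 𝔽_q[x] with exactly d distinct monic irreducible factors such that G is isomorphic to an induced subgraph of the unitary Cayley graph G_{F_d}({1}) on 𝔽_q[x]/(F_d). -/
open Polynomial

variable {Fq : Type} [Field Fq] [Fintype Fq] [DecidableEq Fq]

/-- `ω(h)`: the number of distinct monic irreducible factors of `h`. -/
noncomputable def omegaPoly (h : Polynomial Fq) : ℕ :=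
  Nat.card {π : Polynomial Fq // π.Monic ∧ Irreducible π ∧ π ∣ h}

/-- Infinitely many monic irreducible polynomials do not divide a given nonzero polynomial. -/
theorem infinite_monic_irreducible_not_dvd {K : Type*} [Field K] {M : K[X]} (hM : M ≠ 0) :
    {p : K[X] | p.Monic ∧ Irreducible p ∧ ¬ p ∣ M}.Infinite := by
  intro hfin
  set P : K[X] := M * ∏ p ∈ hfin.toFinset, p with hP
  have hP0 : P ≠ 0 := by
    refine mul_ne_zero hM (Finset.prod_ne_zero_iff.2 fun p hp => ?_)
    exact ((hfin.mem_toFinset.1 hp).1).ne_zero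
  have hnu : ¬ IsUnit (P * X + 1) := by
    refine not_isUnit_of_natDegree_pos _ ?_
    rw [← C_1, natDegree_add_C, natDegree_mul_X hP0]
    exact Nat.succ_pos _
  obtain ⟨g, hgm, hgi, hgd⟩ := exists_monic_irreducible_factor _ hnu
  have hgP : ¬ g ∣ P := fun h => hgi.not_isUnit <| isUnit_of_dvd_one <|
    (dvd_add_right (h.mul_right X)).1 hgd
  have hgM : ¬ g ∣ M := fun h => hgP (h.mul_right _)
  exact hgP ((Finset.dvd_prod_of_mem (fun p => p) (hfin.mem_toFinset.2 ⟨hgm, hgi, hgM⟩)).mul_left _)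

/-- Every finite graph is described by sufficiently many coordinate self-maps of its vertex
set: adjacency means that all coordinates differ, and the coordinates separate vertices. -/
theorem SimpleGraph.exists_coordinates {V : Type*} [Fintype V] (G : SimpleGraph V) {d : ℕ}
    (hd : Fintype.card (Option (V × V)) ≤ d) :
    ∃ c : Fin d → V → V, (∃ i, Function.Injective (c i)) ∧
      ∀ u v, G.Adj u v ↔ ∀ i, c i u ≠ c i v := by
  classical
  obtain ⟨e⟩ : Nonempty (Option (V × V) ↪ Fin d) :=
    Function.Embedding.nonempty_of_card_le (by simpa using hd)
  refine ⟨fun i v => if ∃ b, ¬ G.Adj v b ∧ e (some (v, b)) = i then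
    (Function.invFun e i).elim v Prod.snd else v, ⟨e none, ?_⟩, fun u v => ⟨?_, ?_⟩⟩
  · intro u v h
    simpa using h
  · intro h i
    have hne := h.ne
    dsimp only
    split_ifs with h₁ h₂ h₂
    · obtain ⟨b, hb, rfl⟩ := h₁
      obtain ⟨b', hb', h'⟩ := h₂
      simp_all
    · obtain ⟨b, hb, rfl⟩ := h₁
      rw [Function.leftInverse_invFun e.injective]
      rintro rfl
      exact hb h
    · obtain ⟨b, hb, rfl⟩ := h₂
      rw [Function.leftInverse_invFun e.injective]
      rintro rfl
      exact hb h.symm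
    · exact hne
  · intro h
    by_contra hadj
    refine h (e (some (u, v))) ?_
    have h₁ : ∃ b, ¬ G.Adj u b ∧ e (some (u, b)) = e (some (u, v)) := ⟨v, hadj, rfl⟩
    dsimp only
    rw [if_pos h₁, Function.leftInverse_invFun e.injective]
    split_ifs <;> rfl

theorem omegaPoly_prod {K : Type} [Field K] {d : ℕ} {π : Fin d → K[X]} (hinj : Function.Injective π)
    (hm : ∀ i, (π i).Monic) (hi : ∀ i, Irreducible (π i)) : omegaPoly (∏ i, π i) = d := by
  refine (Nat.card_eq_of_bijective (fun i : Fin d =>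
    (⟨π i, hm i, hi i, Finset.dvd_prod_of_mem π (Finset.mem_univ i)⟩ :
      {p : K[X] // p.Monic ∧ Irreducible p ∧ p ∣ ∏ i, π i})) ⟨?_, ?_⟩).symm.trans (Nat.card_fin d)
  · intro i j h
    exact hinj (congrArg Subtype.val h)
  · rintro ⟨p, hpm, hpi, hpd⟩
    obtain ⟨i, -, h⟩ := (hpi.prime.dvd_finsetProd_iff π).1 hpd
    exact ⟨i, Subtype.ext (eq_of_monic_of_associated (hm i) hpm
      (hpi.associated_of_dvd (hi i) h).symm)⟩

/-- In a unitary Cayley graph, adjacency of residue classes is coprimality of the difference of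
representatives with the modulus. -/
theorem gcdGraph_one_adj_mk {K : Type} [Field K] [DecidableEq K] {f p q : K[X]} :
    (gcdGraph f {1}).Adj (AdjoinRoot.mk f p) (AdjoinRoot.mk f q) ↔
      AdjoinRoot.mk f p ≠ AdjoinRoot.mk f q ∧ IsCoprime (p - q) f := by
  have key (a b : K[X]) : (∃ s : K[X], AdjoinRoot.mk f s = AdjoinRoot.mk f a - AdjoinRoot.mk f b ∧
      gcd s f ∈ ({1} : Finset K[X])) ↔ IsCoprime (a - b) f := by
    have hone (s : K[X]) : gcd s f ∈ ({1} : Finset K[X]) ↔ IsCoprime s f := by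
      rw [Finset.mem_singleton, ← gcd_isUnit_iff, ← normalize_eq_one, normalize_gcd]
    simp only [hone, ← map_sub, AdjoinRoot.mk_eq_mk]
    refine ⟨?_, fun h => ⟨a - b, by simp, h⟩⟩
    rintro ⟨s, ⟨t, ht⟩, hs⟩
    have : a - b = s + f * (-t) := by linear_combination -ht
    rw [this]
    exact IsCoprime.add_mul_left_left hs _
  rw [gcdGraph, SimpleGraph.fromRel_adj, key, key, ← neg_sub p q, IsCoprime.neg_left_iff, or_self]

/-- A system of separating coordinates realizes a graph inside a unitary Cayley graph, provided
the moduli separate representatives of the vertices. -/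
theorem nonempty_embedding_gcdGraph_prod {K : Type} [Field K] [DecidableEq K]
    {V : Type*} (G : SimpleGraph V) {d : ℕ}
    {c : Fin d → V → V} (hc : ∃ i, Function.Injective (c i))
    (hadj : ∀ u v, G.Adj u v ↔ ∀ i, c i u ≠ c i v)
    {π : Fin d → K[X]} (hinj : Function.Injective π) (hm : ∀ i, (π i).Monic)
    (hi : ∀ i, Irreducible (π i)) {x : V → K[X]}
    (hx : ∀ i u v, u ≠ v → ¬ π i ∣ x u - x v) :
    Nonempty (G ↪g gcdGraph (∏ i, π i) {1}) := by
  have hcop : Pairwise (Function.onFun IsCoprime fun i => Ideal.span {π i}) := by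
    intro i j hij
    rw [Function.onFun, Ideal.isCoprime_span_singleton_iff, (hi i).coprime_iff_not_dvd]
    exact fun h => hij <| hinj <|
      eq_of_monic_of_associated (hm i) (hm j) ((hi i).associated_of_dvd (hi j) h)
  choose r hr using fun v => Ideal.exists_forall_sub_mem_ideal hcop fun i => x (c i v)
  have hdvd (i : Fin d) (u v : V) : π i ∣ r u - r v ↔ c i u = c i v := by
    have hu := Ideal.mem_span_singleton.1 (hr u i)
    have hv := Ideal.mem_span_singleton.1 (hr v i)
    have : r u - r v = (x (c i u) - x (c i v)) + ((r u - x (c i u)) - (r v - x (c i v))) := by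
      ring
    rw [this, dvd_add_left (dvd_sub hu hv)]
    refine ⟨fun h => by_contra fun hne => hx i _ _ hne h, fun h => by simp [h]⟩
  have hmk : Function.Injective fun v => AdjoinRoot.mk (∏ i, π i) (r v) := by
    intro u v h
    obtain ⟨i, hci⟩ := hc
    exact hci <| (hdvd i u v).1 <|
      (Finset.dvd_prod_of_mem π (Finset.mem_univ i)).trans (AdjoinRoot.mk_eq_mk.1 h)
  refine ⟨⟨⟨_, hmk⟩, fun {u v} => ?_⟩⟩
  have hcoprime : IsCoprime (r u - r v) (∏ i, π i) ↔ G.Adj u v := by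
    simp only [isCoprime_comm (x := r u - r v), IsCoprime.prod_left_iff, Finset.mem_univ,
      true_implies, hadj, Ne, ← hdvd, (hi _).coprime_iff_not_dvd]
  simp only [Function.Embedding.coeFn_mk]
  rw [gcdGraph_one_adj_mk, hcoprime]
  exact and_iff_right_of_imp fun h => hmk.ne h.ne

/-- Over any field there are arbitrarily many distinct monic irreducible polynomials modulo each
of which finitely many given distinct polynomials stay distinct. -/
theorem exists_monic_irreducible_family {K V : Type*} [Field K] [Fintype V] {x : V → K[X]}
    (hx : Function.Injective x) (d : ℕ) :
    ∃ π : Fin d → K[X], Function.Injective π ∧ (∀ i, (π i).Monic) ∧ (∀ i, Irreducible (π i)) ∧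
      ∀ i u v, u ≠ v → ¬ π i ∣ x u - x v := by
  classical
  obtain ⟨M, hM, hdvd⟩ : ∃ M : K[X], M ≠ 0 ∧ ∀ u v, u ≠ v → x u - x v ∣ M := by
    refine ⟨∏ w ∈ Finset.univ.offDiag, (x w.1 - x w.2), Finset.prod_ne_zero_iff.2 fun w hw =>
      sub_ne_zero.2 (hx.ne (Finset.mem_offDiag.1 hw).2.2), fun u v huv => ?_⟩
    exact Finset.dvd_prod_of_mem (fun w : V × V => x w.1 - x w.2) (a := (u, v)) (by simpa using huv)
  obtain ⟨t, ht, hcard⟩ := (infinite_monic_irreducible_not_dvd hM).exists_subset_card_eq d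
  let φ : Fin d ≃ t := (t.equivFinOfCardEq hcard).symm
  have hφ (i : Fin d) := ht (φ i).2
  exact ⟨fun i => φ i, Subtype.val_injective.comp φ.injective, fun i => (hφ i).1,
    fun i => (hφ i).2.1, fun i u v huv h => (hφ i).2.2 (h.trans (hdvd u v huv))⟩

/-- For every finite simple graph `G` there is an `r > 0` such that for each `d ≥ r` there
is a monic `F_d ∈ 𝔽_q[x]` with exactly `d` distinct monic irreducible factors for which `G`
is an induced subgraph of the unitary Cayley graph `G_{F_d}({1})`. -/
theorem exists_induced_in_unitary_cayley
    {V : Type} [Fintype V] (G : SimpleGraph V) :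
    ∃ r : ℕ, 0 < r ∧ ∀ d : ℕ, r ≤ d →
      ∃ F : Polynomial Fq, F.Monic ∧ omegaPoly F = d ∧
        Nonempty (G ↪g gcdGraph F {1}) := by
  refine ⟨Fintype.card (Option (V × V)), Fintype.card_pos, fun d hd => ?_⟩
  obtain ⟨c, hc, hadj⟩ := G.exists_coordinates hd
  have hx : Function.Injective fun v => (X : Fq[X]) ^ (Fintype.equivFin V v : ℕ) := fun u v h => by
    simpa [Fin.val_inj] using congrArg natDegree h
  obtain ⟨π, hinj, hm, hi, hπ⟩ := exists_monic_irreducible_family hx d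
  exact ⟨∏ i, π i, monic_prod_of_monic _ _ fun i _ => hm i, omegaPoly_prod hinj hm hi,
    nonempty_embedding_gcdGraph_prod G hc hadj hinj hm hi hπ⟩
end
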